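/- arXiv:1506.03684 — 2 statements merged into one kernel-verified Lean document; each statement's English description precedes it below -/
import Mathlib

section
/- For all integers n, t, m ≥ 1, every fixed strict total order ≻ on {1,…,n}, all valuation profiles v¹,…,vᵐ ∈ ℝⁿ, and all targets r¹,…,rᵐ ∈ ℝ, the number of distinct subsets of {1,…,m} of the form {j : Rev_A(vʲ) ≥ rʲ}, as A ranges over all t-level single-item auctions for n bidders with tie-breaking order ≻, is at most (nm + nt)^{3nt}. -/
open MeasureTheory
open scoped ENNReal

attribute [local instance] Classical.propDecidable

/-- A `t`-level single-item auction for `n` bidders: nondecreasing thresholds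
`thr i 0 ≤ thr i 1 ≤ … ≤ thr i (t-1)` for each bidder `i`. -/
structure TLevel (n t : ℕ) where
  thr : Fin n → Fin t → ℝ
  mono : ∀ i, Monotone (thr i)

namespace TLevel

/-- The level of a bid `b` for bidder `i`: the largest index `τ` with `thr i τ ≤ b`,
or `-1` if no threshold is met (computed as the number of met thresholds minus one,
which coincides with the largest met index since the thresholds are nondecreasing). -/
noncomputable def level {n t : ℕ} (A : TLevel n t) (i : Fin n) (b : ℝ) : ℤ :=
  ((Finset.univ.filter fun τ : Fin t => A.thr i τ ≤ b).card : ℤ) - 1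

/-- Bidder `i` wins: her level is ≥ 0 and she beats every other bidder, either by a
strictly higher level or by the tie-breaking order `succ` at equal levels. -/
def wins {n t : ℕ} (A : TLevel n t) (succ : Fin n → Fin n → Prop)
    (v : Fin n → ℝ) (i : Fin n) : Prop :=
  0 ≤ A.level i (v i) ∧ ∀ j : Fin n, j ≠ i →
    (A.level j (v j) < A.level i (v i) ∨
      (A.level j (v j) = A.level i (v i) ∧ succ i j))

/-- The winner's payment: the infimum over bids at which she would still win. -/
noncomputable def payment {n t : ℕ} (A : TLevel n t) (succ : Fin n → Fin n → Prop)
    (v : Fin n → ℝ) (i : Fin n) : ℝ :=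
  sInf {b : ℝ | A.wins succ (Function.update v i b) i}

/-- The revenue of the auction on profile `v`: the winner (if any) pays her
critical bid; losers pay nothing. -/
noncomputable def Rev {n t : ℕ} (A : TLevel n t) (succ : Fin n → Fin n → Prop)
    (v : Fin n → ℝ) : ℝ :=
  ∑ i : Fin n, if A.wins succ v i then A.payment succ v i else 0

end TLevel

namespace TLevel

variable {n t : ℕ} {succ : Fin n → Fin n → Prop} {v : Fin n → ℝ}

lemma le_level_iff (A : TLevel n t) (i : Fin n) (b : ℝ) (τ : Fin t) :
    ((τ : ℕ) : ℤ) ≤ A.level i b ↔ A.thr i τ ≤ b := by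
  unfold level
  constructor
  · intro h
    by_contra hb
    have hsub : (Finset.univ.filter fun σ : Fin t => A.thr i σ ≤ b) ⊆ Finset.Iio τ := by
      intro σ hσ
      simp only [Finset.mem_filter, Finset.mem_univ, true_and] at hσ
      rw [Finset.mem_Iio]
      by_contra hlt
      exact hb ((A.mono i (not_lt.mp hlt)).trans hσ)
    have hcard := Finset.card_le_card hsub
    rw [Fin.card_Iio] at hcard
    omega
  · intro h
    have hsub : Finset.Iic τ ⊆ (Finset.univ.filter fun σ : Fin t => A.thr i σ ≤ b) := by
      intro σ hσ
      simp only [Finset.mem_filter, Finset.mem_univ, true_and]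
      exact (A.mono i (Finset.mem_Iic.mp hσ)).trans h
    have hcard := Finset.card_le_card hsub
    rw [Fin.card_Iic] at hcard
    omega

lemma level_lt (A : TLevel n t) (i : Fin n) (b : ℝ) : A.level i b < t := by
  have h := Finset.card_le_univ (Finset.univ.filter fun τ : Fin t => A.thr i τ ≤ b)
  rw [Fintype.card_fin] at h
  unfold level
  omega

lemma wins_update_iff (A : TLevel n t) (i : Fin n) (b : ℝ) :
    A.wins succ (Function.update v i b) i ↔
      0 ≤ A.level i b ∧ ∀ j : Fin n, j ≠ i →
        (A.level j (v j) < A.level i b ∨ (A.level j (v j) = A.level i b ∧ succ i j)) := by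
  unfold wins
  rw [Function.update_self]
  refine and_congr_right fun _ => forall_congr' fun j => forall_congr' fun hj => ?_
  rw [Function.update_of_ne hj]

/-- The critical bid of a winner is one of her thresholds, whose index depends on the auction
only through the levels of the bids. -/
lemma exists_payment_eq_thr {A : TLevel n t} {i : Fin n} (hw : A.wins succ v i) :
    ∃ τ : Fin t, ∀ B : TLevel n t, (∀ j, B.level j (v j) = A.level j (v j)) →
      B.payment succ v i = B.thr i τ := by
  let P : ℕ → Prop := fun k => ∀ j : Fin n, j ≠ i →
    (A.level j (v j) < k ∨ (A.level j (v j) = k ∧ succ i j))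
  have hP : P (A.level i (v i)).toNat := by
    intro j hj
    rw [Int.toNat_of_nonneg hw.1]
    exact hw.2 j hj
  have hex : ∃ k, P k := ⟨_, hP⟩
  have hlt : Nat.find hex < t := by
    have h₁ := Nat.find_min' hex hP
    have h₂ := A.level_lt i (v i)
    have h₃ := hw.1
    omega
  refine ⟨⟨Nat.find hex, hlt⟩, fun B hB => ?_⟩
  have hset : {b : ℝ | B.wins succ (Function.update v i b) i} =
      Set.Ici (B.thr i ⟨Nat.find hex, hlt⟩) := by
    ext b
    rw [Set.mem_ofPred_eq, wins_update_iff, Set.mem_Ici, ← le_level_iff]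
    simp only [hB]
    constructor
    · rintro ⟨h0, h⟩
      have hb : P (B.level i b).toNat := by
        intro j hj
        rw [Int.toNat_of_nonneg h0]
        exact h j hj
      have := Nat.find_min' hex hb
      omega
    · intro h
      refine ⟨by omega, fun j hj => ?_⟩
      rcases Nat.find_spec hex j hj with h' | ⟨h', hs⟩
      · exact Or.inl (h'.trans_le h)
      · rcases (h'.trans_le h).lt_or_eq with h'' | h''
        · exact Or.inl h''
        · exact Or.inr ⟨h'', hs⟩
  rw [payment, hset, csInf_Ici]

lemma wins_unique [IsStrictTotalOrder (Fin n) succ] {A : TLevel n t} {i j : Fin n}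
    (hi : A.wins succ v i) (hj : A.wins succ v j) : i = j := by
  by_contra hne
  rcases hi.2 j (Ne.symm hne) with h | ⟨h, hs⟩
  · rcases hj.2 i hne with h' | ⟨h', -⟩ <;> omega
  · rcases hj.2 i hne with h' | ⟨-, hs'⟩
    · omega
    · exact asymm_of succ hs hs'

lemma rev_eq_payment [IsStrictTotalOrder (Fin n) succ] {A : TLevel n t} {i : Fin n}
    (hi : A.wins succ v i) : A.Rev succ v = A.payment succ v i := by
  rw [Rev, Finset.sum_eq_single i, if_pos hi]
  · intro j _ hj
    exact if_neg fun h => hj (wins_unique h hi)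
  · simp

lemma rev_eq_zero {A : TLevel n t} (h : ∀ i, ¬ A.wins succ v i) : A.Rev succ v = 0 :=
  Finset.sum_eq_zero fun i _ => if_neg (h i)

/-- Whether the revenue reaches a target is determined by how the thresholds compare with the
valuations and with the target. -/
lemma le_rev_congr [IsStrictTotalOrder (Fin n) succ] {A B : TLevel n t} {r : ℝ}
    (hv : ∀ i τ, A.thr i τ ≤ v i ↔ B.thr i τ ≤ v i)
    (hr : ∀ i τ, r ≤ A.thr i τ ↔ r ≤ B.thr i τ) :
    r ≤ A.Rev succ v ↔ r ≤ B.Rev succ v := by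
  have hlevel : ∀ j, B.level j (v j) = A.level j (v j) := by
    intro j
    simp only [level, hv]
  have hwins : ∀ i, A.wins succ v i ↔ B.wins succ v i := by
    intro i
    simp only [wins, hlevel]
  by_cases hex : ∃ i, A.wins succ v i
  · obtain ⟨i, hi⟩ := hex
    obtain ⟨τ, hτ⟩ := exists_payment_eq_thr hi
    rw [rev_eq_payment hi, rev_eq_payment ((hwins i).mp hi), hτ A fun _ => rfl, hτ B hlevel]
    exact hr i τ
  · push Not at hex
    rw [rev_eq_zero hex, rev_eq_zero fun i h => hex i ((hwins i).mpr h)]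

/-- For each threshold, the number of samples whose valuation meets it and the number of samples
whose target it reaches. -/
noncomputable def thresholdRanks {m : ℕ} (v : Fin m → Fin n → ℝ) (r : Fin m → ℝ)
    (A : TLevel n t) (i : Fin n) (τ : Fin t) : Fin (m + 1) × Fin (m + 1) :=
  (⟨(Finset.univ.filter fun j => A.thr i τ ≤ v j i).card,
      Nat.lt_succ_of_le ((Finset.card_le_univ _).trans_eq (Fintype.card_fin m))⟩,
    ⟨(Finset.univ.filter fun j => r j ≤ A.thr i τ).card,
      Nat.lt_succ_of_le ((Finset.card_le_univ _).trans_eq (Fintype.card_fin m))⟩)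

end TLevel

lemma le_iff_le_of_card_filter_le_eq {ι : Type*} [Fintype ι] {w : ι → ℝ} {a b : ℝ}
    (h : (Finset.univ.filter fun j => a ≤ w j).card = (Finset.univ.filter fun j => b ≤ w j).card)
    (j : ι) : a ≤ w j ↔ b ≤ w j := by
  wlog hab : a ≤ b generalizing a b
  · exact (this h.symm (le_of_not_ge hab)).symm
  have heq := Finset.eq_of_subset_of_card_le
    (Finset.monotone_filter_right Finset.univ fun k _ (hk : b ≤ w k) => hab.trans hk) h.le
  simpa using (Finset.ext_iff.mp heq j).symm

lemma le_iff_le_of_card_filter_ge_eq {ι : Type*} [Fintype ι] {w : ι → ℝ} {a b : ℝ}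
    (h : (Finset.univ.filter fun j => w j ≤ a).card = (Finset.univ.filter fun j => w j ≤ b).card)
    (j : ι) : w j ≤ a ↔ w j ≤ b := by
  have h' := le_iff_le_of_card_filter_le_eq (w := fun k => -w k) (a := -a) (b := -b)
    (by simpa only [neg_le_neg_iff] using h) j
  simpa only [neg_le_neg_iff] using h'

/-- For all `n, t, m ≥ 1`, a fixed strict total tie-breaking order `succ`, valuation
profiles `v¹,…,vᵐ` and targets `r¹,…,rᵐ`, the number of distinct subsets of samples of
the form `{j : Rev_A(vʲ) ≥ rʲ}`, over all `t`-level single-item auctions `A`, is at most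
`(nm + nt)^{3nt}`. -/
theorem count_labelings_tlevel_single_item :
    ∀ n t m : ℕ, 1 ≤ n → 1 ≤ t → 1 ≤ m →
    ∀ succ : Fin n → Fin n → Prop, IsStrictTotalOrder (Fin n) succ →
    ∀ (v : Fin m → (Fin n → ℝ)) (r : Fin m → ℝ),
      Set.ncard {T : Finset (Fin m) | ∃ A : TLevel n t,
          T = Finset.univ.filter fun j => r j ≤ A.Rev succ (v j)} ≤
        (n * m + n * t) ^ (3 * n * t) := by
  intro n t m hn ht hm succ hsucc v r
  let label : TLevel n t → Finset (Fin m) := fun A =>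
    Finset.univ.filter fun j => r j ≤ A.Rev succ (v j)
  have hfactor : Function.FactorsThrough label (TLevel.thresholdRanks v r) := by
    intro A B hAB
    have hrank := fun i τ => Prod.ext_iff.mp (congrFun (congrFun hAB i) τ)
    refine Finset.filter_congr fun j _ => TLevel.le_rev_congr (fun i τ => ?_) fun i τ => ?_
    · exact le_iff_le_of_card_filter_le_eq (w := fun k => v k i)
        (Fin.ext_iff.mp (hrank i τ).1) j
    · exact le_iff_le_of_card_filter_ge_eq (w := r) (Fin.ext_iff.mp (hrank i τ).2) j
  have hsub : {T : Finset (Fin m) | ∃ A : TLevel n t,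
      T = Finset.univ.filter fun j => r j ≤ A.Rev succ (v j)} ⊆
      Set.range (Function.extend (TLevel.thresholdRanks v r) label fun _ => ∅) := by
    rintro T ⟨A, rfl⟩
    exact ⟨TLevel.thresholdRanks v r A, hfactor.extend_apply _ A⟩
  have hbase : (m + 1) * (m + 1) ≤ (n * m + n * t) ^ 3 := by
    have h : m + 1 ≤ n * m + n * t :=
      Nat.add_le_add (Nat.le_mul_of_pos_left m hn) (Nat.mul_pos hn ht)
    calc (m + 1) * (m + 1) = (m + 1) ^ 2 := (sq _).symm
      _ ≤ (m + 1) ^ 3 := Nat.pow_le_pow_right m.succ_pos (by norm_num)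
      _ ≤ (n * m + n * t) ^ 3 := Nat.pow_le_pow_left h 3
  calc _ ≤ (Set.range (Function.extend (TLevel.thresholdRanks v r) label fun _ => ∅)).ncard :=
        Set.ncard_le_ncard hsub (Set.toFinite _)
    _ ≤ Nat.card (Fin n → Fin t → Fin (m + 1) × Fin (m + 1)) := by
        rw [← Set.image_univ, ← Set.ncard_univ]
        exact Set.ncard_image_le
    _ = ((m + 1) * (m + 1)) ^ (n * t) := by
        simp [Nat.card_eq_fintype_card, ← pow_mul, mul_comm t n]
    _ ≤ ((n * m + n * t) ^ 3) ^ (n * t) := Nat.pow_le_pow_left hbase _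
    _ = (n * m + n * t) ^ (3 * n * t) := by rw [← pow_mul, mul_assoc]
end

section
/- There is a universal constant c > 0 with the following property. Let n ≥ 1 be an integer, H > 0, α ∈ (0,H], and γ, ε ∈ (0,1). Let F = F₁ ⊗ … ⊗ F_n be a product probability measure on ℝⁿ whose marginals F_i are atomless and supported in [0,H], and suppose P_{v∼F}[max_i v_i > α] ≥ γ. Then for every integer t ≥ c·(1/(γ·ε) + ln(H/α)/ln(1+ε)) and every strict total order ≻ on {1,…,n}, there exists a t-level single-item auction A with tie-breaking order ≻ such that E_{v∼F}[Rev_A(v)] ≥ (1−ε)·OPT(F). -/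
open MeasureTheory
open scoped ENNReal

attribute [local instance] Classical.propDecidable

/-- A deterministic DSIC-IR single-item auction for `n` bidders with valuations in `V`:
a measurable 0/1 allocation awarding at most one item, and measurable nonnegative payments
bounded by value times allocation, such that truthful bidding is a dominant strategy. -/
structure SIAuction (n : ℕ) (V : Set ℝ) where
  alloc : (Fin n → ℝ) → Fin n → ℝ
  pay : (Fin n → ℝ) → Fin n → ℝ
  alloc_meas : ∀ i, Measurable fun v => alloc v i
  pay_meas : ∀ i, Measurable fun v => pay v i
  alloc01 : ∀ v i, alloc v i = 0 ∨ alloc v i = 1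
  feas : ∀ v, (∑ i, alloc v i) ≤ 1
  pay_nonneg : ∀ v i, 0 ≤ pay v i
  pay_le : ∀ v, (∀ j, v j ∈ V) → ∀ i, pay v i ≤ v i * alloc v i
  dsic : ∀ v : Fin n → ℝ, (∀ j, v j ∈ V) → ∀ (i : Fin n) (b : ℝ), b ∈ V →
    v i * alloc (Function.update v i b) i - pay (Function.update v i b) i ≤
      v i * alloc v i - pay v i

/-- `OPT n V F`: the supremum of expected revenue over all DSIC-IR single-item
auctions with valuations in `V`, for bid distribution `F`. -/
noncomputable def OPT (n : ℕ) (V : Set ℝ) (F : Measure (Fin n → ℝ)) : ℝ≥0∞ :=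
  ⨆ A : SIAuction n V, ∫⁻ v, ∑ i, ENNReal.ofReal (A.pay v i) ∂F

section PriceBounds

open Set

theorem sum_Ico_ite_lt_sub (f : ℕ → ℝ) {m N t : ℕ} (hmN : m ≤ N) (hNt : N ≤ t) :
    ∑ j ∈ Finset.Ico m t, (if j < N then f (j + 1) - f j else 0) = f N - f m := by
  rw [← Finset.sum_filter]
  have : (Finset.Ico m t).filter (· < N) = Finset.Ico m N := by
    ext j; simp; omega
  rw [this, Finset.sum_Ico_sub f hmN]

theorem continuous_real_Ici (μ : Measure ℝ) [IsProbabilityMeasure μ] [NullSingletonClass μ] :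
    Continuous fun p => μ.real (Ici p) := by
  have h := intervalIntegral.continuous_primitive (f := fun _ : ℝ => (1 : ℝ)) (μ := μ)
    (fun a b => by simp) 0
  have : (fun p => μ.real (Ici p)) =
      fun p => μ.real (Ioi 0) - ∫ _x in (0 : ℝ)..p, (1 : ℝ) ∂μ := by
    funext p
    have := intervalIntegral.integral_Ioi_sub_Ioi' (f := fun _ : ℝ => (1 : ℝ)) (μ := μ)
      (a := 0) (b := p) (integrable_const _).integrableOn (integrable_const _).integrableOn
    rw [← this]
    simp [measureReal_congr (Ioi_ae_eq_Ici (μ := μ) (a := p))]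
  rw [this]
  exact continuous_const.sub h

theorem real_Ici_top_eq_zero {μ : Measure ℝ} [IsProbabilityMeasure μ] [NullSingletonClass μ] {H : ℝ}
    (hsupp : μ (Icc 0 H) = 1) : μ.real (Ici H) = 0 := by
  rw [← measureReal_congr (Ioi_ae_eq_Ici (μ := μ) (a := H)), measureReal_eq_zero_iff]
  refine measure_mono_null (t := (Icc 0 H)ᶜ) (fun x hx => ?_) ?_
  · simp only [mem_compl_iff, mem_Icc, not_and, not_le]
    exact fun _ => hx
  · rw [prob_compl_eq_zero_iff measurableSet_Icc, hsupp]

/-- For each `r` the largest maximizer of `p ↦ (p - r) * μ [p, ∞)` is monotone in `r`. -/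
theorem exists_monotone_optimal_price (μ : Measure ℝ) [IsProbabilityMeasure μ] [NullSingletonClass μ]
    {H : ℝ} (hH : 0 < H) :
    ∃ ℓ : ℝ → ℝ, Monotone ℓ ∧ (∀ r, ℓ r ∈ Icc 0 H) ∧
      ∀ r, ∀ p ∈ Icc 0 H, (p - r) * μ.real (Ici p) ≤ (ℓ r - r) * μ.real (Ici (ℓ r)) := by
  have hG := continuous_real_Ici μ
  set G : ℝ → ℝ := fun p => μ.real (Ici p)
  have key : ∀ r, ∃ p, IsGreatest
      {p ∈ Icc 0 H | ∀ q ∈ Icc 0 H, (q - r) * G q ≤ (p - r) * G p} p := by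
    intro r
    have hc : Continuous fun p => (p - r) * G p := by fun_prop
    have hne : (Icc 0 H).Nonempty := ⟨0, by simp [hH.le]⟩
    obtain ⟨p, hp, hmax⟩ := isCompact_Icc.exists_isMaxOn hne hc.continuousOn
    refine IsCompact.exists_isGreatest ?_ ⟨p, hp, fun q hq => hmax hq⟩
    refine isCompact_Icc.inter_right (t := {p | ∀ q ∈ Icc 0 H, (q - r) * G q ≤ (p - r) * G p}) ?_
    simp only [ofPred_forall]
    exact isClosed_biInter fun q _ => isClosed_le continuous_const hc
  choose ℓ hℓ using key
  refine ⟨ℓ, fun r r' hr => ?_, fun r => (hℓ r).1.1, fun r => (hℓ r).1.2⟩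
  by_contra! hlt
  have hr' : r < r' := lt_of_le_of_ne hr (by rintro rfl; exact lt_irrefl _ hlt)
  have h1 := (hℓ r).1.2 _ (hℓ r').1.1
  have h2 := (hℓ r').1.2 _ (hℓ r).1.1
  have h3 : G (ℓ r) ≤ G (ℓ r') := measureReal_mono (Ici_subset_Ici.2 hlt.le)
  have h4 : G (ℓ r) = G (ℓ r') := by
    refine le_antisymm h3 ?_
    by_contra! h
    nlinarith
  rw [← h4] at h1 h2
  have h5 : G (ℓ r) = 0 := by
    refine le_antisymm ?_ measureReal_nonneg
    by_contra! h
    nlinarith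
  have := (hℓ r').2 (show ℓ r ∈ _ from ⟨(hℓ r).1.1, fun q hq => by
    have := (hℓ r').1.2 q hq
    rw [← h4, h5] at this
    rw [h5]; linarith⟩)
  linarith

section SingleBidder

variable {μ : Measure ℝ} [IsProbabilityMeasure μ] {H : ℝ} {t : ℕ} {ℓ r : ℕ → ℝ}
  {N : ℝ → ℕ}

/-- A posted price earns no more than the upper discretized virtual surplus it induces. -/
theorem price_mul_le_setLIntegral (hr : Monotone r) (hr0 : r 0 = 0) (hrt : H ≤ r t)
    (hℓ : ∀ j, ℓ j ∈ Icc 0 H)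
    (hopt : ∀ j, ∀ p ∈ Icc 0 H,
      (p - r j) * μ.real (Ici p) ≤ (ℓ j - r j) * μ.real (Ici (ℓ j)))
    (hNt : ∀ x, N x ≤ t) (hN : ∀ x, ∀ j < t, j < N x ↔ ℓ j ≤ x) {p : ℝ} (hp : p ∈ Icc 0 H) :
    ENNReal.ofReal p * μ (Ici p) ≤ ∫⁻ x in Ici p, ENNReal.ofReal (r (N x)) ∂μ := by
  set m := N p with hm
  have hrn : ∀ j, 0 ≤ r j := fun j => hr0 ▸ hr (Nat.zero_le j)
  have hd : ∀ j, 0 ≤ r (j + 1) - r j := fun j => sub_nonneg.2 (hr (Nat.le_succ j))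
  have htel : ∀ s, m ≤ s → (ℓ m - r m) * μ.real (Ici (ℓ m)) ≤
      (ℓ s - r s) * μ.real (Ici (ℓ s)) +
        ∑ j ∈ Finset.Ico m s, (r (j + 1) - r j) * μ.real (Ici (ℓ j)) := by
    intro s hs
    induction s, hs using Nat.le_induction with
    | base => simp
    | succ s hs ih =>
      rw [Finset.sum_Ico_succ_top hs]
      linarith [hopt (s + 1) (ℓ s) (hℓ s)]
  have hreal : p * μ.real (Ici p) ≤ r m * μ.real (Ici p) +
      ∑ j ∈ Finset.Ico m t, (r (j + 1) - r j) * μ.real (Ici (ℓ j)) := by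
    have h1 := htel t (hNt p)
    have h2 := hopt m p hp
    have h3 : (ℓ t - r t) * μ.real (Ici (ℓ t)) ≤ 0 :=
      mul_nonpos_of_nonpos_of_nonneg (by linarith [(hℓ t).2]) measureReal_nonneg
    linarith
  calc ENNReal.ofReal p * μ (Ici p) = ENNReal.ofReal (p * μ.real (Ici p)) := by
        rw [ENNReal.ofReal_mul hp.1, ofReal_measureReal]
    _ ≤ ENNReal.ofReal (r m * μ.real (Ici p) +
        ∑ j ∈ Finset.Ico m t, (r (j + 1) - r j) * μ.real (Ici (ℓ j))) :=
      ENNReal.ofReal_le_ofReal hreal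
    _ = ENNReal.ofReal (r m) * μ (Ici p) +
        ∑ j ∈ Finset.Ico m t, ENNReal.ofReal (r (j + 1) - r j) * μ (Ici (ℓ j)) := by
      rw [ENNReal.ofReal_add (mul_nonneg (hrn m) measureReal_nonneg)
        (Finset.sum_nonneg fun j _ => mul_nonneg (hd j) measureReal_nonneg),
        ENNReal.ofReal_mul (hrn m), ofReal_measureReal,
        ENNReal.ofReal_sum_of_nonneg fun j _ => mul_nonneg (hd j) measureReal_nonneg]
      congr 1
      exact Finset.sum_congr rfl fun j _ => by
        rw [ENNReal.ofReal_mul (hd j), ofReal_measureReal]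
    _ = ∫⁻ x in Ici p, (ENNReal.ofReal (r m) + ∑ j ∈ Finset.Ico m t,
        (Ici (ℓ j)).indicator (fun _ => ENNReal.ofReal (r (j + 1) - r j)) x) ∂μ := by
      rw [lintegral_add_left measurable_const,
        lintegral_finsetSum _ fun j _ => measurable_const.indicator measurableSet_Ici,
        setLIntegral_const]
      congr 1
      refine Finset.sum_congr rfl fun j hj => ?_
      rw [lintegral_indicator_const measurableSet_Ici, Measure.restrict_apply measurableSet_Ici,
        inter_eq_left.2]
      rw [Finset.mem_Ico] at hj
      refine Ici_subset_Ici.2 (le_of_lt (not_le.1 fun h => ?_))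
      have := (hN p j hj.2).2 h
      omega
    _ = ∫⁻ x in Ici p, ENNReal.ofReal (r (N x)) ∂μ := by
      refine setLIntegral_congr_fun measurableSet_Ici fun x hx => ?_
      have hmx : m ≤ N x := by
        by_contra! h
        have h1 : N x < t := lt_of_lt_of_le h (hNt p)
        exact lt_irrefl _ ((hN x _ h1).2 (((hN p _ h1).1 h).trans hx))
      have h := sum_Ico_ite_lt_sub r hmx (hNt x)
      have h2 : r (N x) = r m + ∑ j ∈ Finset.Ico m t,
          (if j < N x then r (j + 1) - r j else 0) := by rw [h]; ring
      rw [h2, ENNReal.ofReal_add (hrn m) (Finset.sum_nonneg fun j _ => by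
        split_ifs <;> simp [hd]), ENNReal.ofReal_sum_of_nonneg fun j _ => by
        split_ifs <;> simp [hd]]
      congr 1
      refine Finset.sum_congr rfl fun j hj => ?_
      rw [Finset.mem_Ico] at hj
      simp only [indicator, mem_Ici, hN x j hj.2]
      split_ifs <;> simp

/-- Posting the `k`-th threshold earns at least the lower discretized virtual surplus. -/
theorem setLIntegral_le_threshold_mul [NullSingletonClass μ] (hH : 0 ≤ H) (hsupp : μ (Icc 0 H) = 1) (hr : Monotone r)
    (hr0 : r 0 = 0) (hℓ : ∀ j, ℓ j ∈ Icc 0 H)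
    (hopt : ∀ j, ∀ p ∈ Icc 0 H,
      (p - r j) * μ.real (Ici p) ≤ (ℓ j - r j) * μ.real (Ici (ℓ j)))
    (hNt : ∀ x, N x ≤ t) (hN : ∀ x, ∀ j < t, j < N x ↔ ℓ j ≤ x) {k : ℕ} (hk : k < t) :
    ∫⁻ x in Ici (ℓ k), ENNReal.ofReal (r (N x - 1)) ∂μ ≤
      ENNReal.ofReal (ℓ k) * μ (Ici (ℓ k)) := by
  have hrn : ∀ j, 0 ≤ r j := fun j => hr0 ▸ hr (Nat.zero_le j)
  have hd : ∀ j, 0 ≤ r (j + 1) - r j := fun j => sub_nonneg.2 (hr (Nat.le_succ j))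
  have htel : ∀ s, k ≤ s → (ℓ s - r s) * μ.real (Ici (ℓ s)) +
        ∑ j ∈ Finset.Ico k s, (r (j + 1) - r j) * μ.real (Ici (ℓ (j + 1))) ≤
      (ℓ k - r k) * μ.real (Ici (ℓ k)) := by
    intro s hs
    induction s, hs using Nat.le_induction with
    | base => simp
    | succ s hs ih =>
      rw [Finset.sum_Ico_succ_top hs]
      linarith [hopt s (ℓ (s + 1)) (hℓ (s + 1))]
  have hreal : r k * μ.real (Ici (ℓ k)) +
      ∑ j ∈ Finset.Ico k (t - 1), (r (j + 1) - r j) * μ.real (Ici (ℓ (j + 1))) ≤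
        ℓ k * μ.real (Ici (ℓ k)) := by
    have h1 := htel (t - 1) (by omega)
    have h2 := hopt (t - 1) H ⟨hH, le_rfl⟩
    rw [real_Ici_top_eq_zero hsupp] at h2
    linarith
  calc ∫⁻ x in Ici (ℓ k), ENNReal.ofReal (r (N x - 1)) ∂μ
    _ = ∫⁻ x in Ici (ℓ k), (ENNReal.ofReal (r k) + ∑ j ∈ Finset.Ico k (t - 1),
        (Ici (ℓ (j + 1))).indicator (fun _ => ENNReal.ofReal (r (j + 1) - r j)) x) ∂μ := by
      refine setLIntegral_congr_fun measurableSet_Ici fun x hx => ?_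
      have hkx : k < N x := (hN x k hk).2 hx
      have h := sum_Ico_ite_lt_sub r (show k ≤ N x - 1 by omega)
        (Nat.sub_le_sub_right (hNt x) 1)
      have h2 : r (N x - 1) = r k + ∑ j ∈ Finset.Ico k (t - 1),
          (if j < N x - 1 then r (j + 1) - r j else 0) := by rw [h]; ring
      rw [h2, ENNReal.ofReal_add (hrn k) (Finset.sum_nonneg fun j _ => by
        split_ifs <;> simp [hd]), ENNReal.ofReal_sum_of_nonneg fun j _ => by
        split_ifs <;> simp [hd]]
      congr 1
      refine Finset.sum_congr rfl fun j hj => ?_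
      rw [Finset.mem_Ico] at hj
      simp only [indicator, mem_Ici, ← hN x (j + 1) (by omega), Nat.lt_sub_iff_add_lt]
      split_ifs <;> simp
    _ ≤ ENNReal.ofReal (r k) * μ (Ici (ℓ k)) + ∑ j ∈ Finset.Ico k (t - 1),
        ENNReal.ofReal (r (j + 1) - r j) * μ (Ici (ℓ (j + 1))) := by
      rw [lintegral_add_left measurable_const,
        lintegral_finsetSum _ fun j _ => measurable_const.indicator measurableSet_Ici,
        setLIntegral_const]
      gcongr with j hj
      rw [lintegral_indicator_const measurableSet_Ici]
      gcongr
      exact Measure.restrict_le_self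
    _ = ENNReal.ofReal (r k * μ.real (Ici (ℓ k)) +
        ∑ j ∈ Finset.Ico k (t - 1), (r (j + 1) - r j) * μ.real (Ici (ℓ (j + 1)))) := by
      rw [ENNReal.ofReal_add (mul_nonneg (hrn k) measureReal_nonneg)
        (Finset.sum_nonneg fun j _ => mul_nonneg (hd j) measureReal_nonneg),
        ENNReal.ofReal_mul (hrn k), ofReal_measureReal,
        ENNReal.ofReal_sum_of_nonneg fun j _ => mul_nonneg (hd j) measureReal_nonneg]
      congr 1
      exact Finset.sum_congr rfl fun j _ => by
        rw [ENNReal.ofReal_mul (hd j), ofReal_measureReal]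
    _ ≤ ENNReal.ofReal (ℓ k * μ.real (Ici (ℓ k))) := ENNReal.ofReal_le_ofReal hreal
    _ = ENNReal.ofReal (ℓ k) * μ (Ici (ℓ k)) := by
      rw [ENNReal.ofReal_mul (hℓ k).1, ofReal_measureReal]

end SingleBidder

end PriceBounds

/-- Resampling one coordinate does not change an integral over a product measure. -/
theorem lintegral_pi_eq_lintegral_update {n : ℕ} (Fi : Fin n → Measure ℝ)
    [∀ i, IsProbabilityMeasure (Fi i)] (i : Fin n) {f : (Fin n → ℝ) → ℝ≥0∞}
    (hf : Measurable f) :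
    ∫⁻ v, f v ∂Measure.pi Fi =
      ∫⁻ v, ∫⁻ x, f (Function.update v i x) ∂Fi i ∂Measure.pi Fi := by
  refine lintegral_eq_of_lmarginal_eq {i} hf ?_ ?_
  · rw [← lmarginal_singleton]
    exact hf.lmarginal Fi
  · funext v
    simp [lmarginal_singleton]

/-- A one-dimensional incentive compatible mechanism is a posted price, so its revenue obeys any
surplus bound valid for posted prices. -/
theorem lintegral_pay_le_lintegral_alloc_mul {μ : Measure ℝ} [NullSingletonClass μ]
    {V : Set ℝ} (hV : ∀ᵐ x ∂μ, x ∈ V) {Φ : ℝ → ℝ≥0∞} {a q : ℝ → ℝ}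
    (hΦ : ∀ p, 0 ≤ p → (∃ b ∈ V, p ≤ b) →
      ENNReal.ofReal p * μ (Set.Ici p) ≤ ∫⁻ x in Set.Ici p, Φ x ∂μ)
    (ha : ∀ x, a x = 0 ∨ a x = 1) (hq : ∀ x, 0 ≤ q x) (hqa : ∀ x ∈ V, q x ≤ x * a x)
    (hic : ∀ x ∈ V, ∀ b ∈ V, x * a b - q b ≤ x * a x - q x) :
    ∫⁻ x, ENNReal.ofReal (q x) ∂μ ≤ ∫⁻ x, ENNReal.ofReal (a x) * Φ x ∂μ := by
  have hlose : ∀ x ∈ V, a x = 0 → q x = 0 := fun x hx h0 =>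
    le_antisymm (by simpa [h0] using hqa x hx) (hq x)
  by_cases hwin : ∃ b ∈ V, a b = 1
  · obtain ⟨b, hb, hab⟩ := hwin
    have hp := hq b
    have hpb : q b ≤ b := by simpa [hab] using hqa b hb
    have hic' : ∀ x ∈ V, x - q b ≤ x * a x - q x := fun x hx => by
      simpa [hab] using hic x hx b hb
    calc ∫⁻ x, ENNReal.ofReal (q x) ∂μ
      _ ≤ ∫⁻ x, (Set.Ici (q b)).indicator (fun _ => ENNReal.ofReal (q b)) x ∂μ := by
        refine lintegral_mono_ae (hV.mono fun x hx => ?_)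
        rcases ha x with h | h
        · simp [hlose x hx h]
        · have h1 := hic b hb x hx
          have h2 := hic' x hx
          have h3 := hqa x hx
          rw [h] at h1 h2 h3
          rw [hab] at h1
          have h4 : q x = q b := by linarith
          rw [Set.indicator_of_mem (by rw [Set.mem_Ici]; linarith), h4]
      _ = ENNReal.ofReal (q b) * μ (Set.Ici (q b)) := by
        rw [lintegral_indicator_const measurableSet_Ici]
      _ ≤ ∫⁻ x in Set.Ici (q b), Φ x ∂μ := hΦ _ hp ⟨b, hb, hpb⟩
      _ = ∫⁻ x in Set.Ioi (q b), Φ x ∂μ := setLIntegral_congr Ioi_ae_eq_Ici.symm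
      _ = ∫⁻ x, (Set.Ioi (q b)).indicator Φ x ∂μ :=
        (lintegral_indicator measurableSet_Ioi _).symm
      _ ≤ ∫⁻ x, ENNReal.ofReal (a x) * Φ x ∂μ := by
        refine lintegral_mono_ae (hV.mono fun x hx => ?_)
        by_cases hx' : x ∈ Set.Ioi (q b)
        · rcases ha x with h | h
          · have h1 := hic' x hx
            rw [h, hlose x hx h] at h1
            rw [Set.mem_Ioi] at hx'
            linarith
          · simp [h, hx']
        · simp [hx']
  · push Not at hwin
    refine lintegral_mono_ae (hV.mono fun x hx => ?_)
    simp [hlose x hx ((ha x).resolve_right (hwin x hx))]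

/-- The expected revenue of a truthful auction is at most the expected largest surplus bound. -/
theorem SIAuction.lintegral_pay_le {n : ℕ} {H : ℝ} (A : SIAuction n (Set.Icc 0 H))
    {Fi : Fin n → Measure ℝ} [∀ i, IsProbabilityMeasure (Fi i)]
    [∀ i, NullSingletonClass (Fi i)] (hsupp : ∀ i, Fi i (Set.Icc 0 H) = 1)
    {Φ : Fin n → ℝ → ℝ≥0∞} (hΦm : ∀ i, Measurable (Φ i))
    (hΦ : ∀ i, ∀ p ∈ Set.Icc 0 H,
      ENNReal.ofReal p * Fi i (Set.Ici p) ≤ ∫⁻ x in Set.Ici p, Φ i x ∂Fi i)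
    {M : (Fin n → ℝ) → ℝ≥0∞} (hM : ∀ v i, Φ i (v i) ≤ M v) :
    ∫⁻ v, ∑ i, ENNReal.ofReal (A.pay v i) ∂Measure.pi Fi ≤ ∫⁻ v, M v ∂Measure.pi Fi := by
  have hV : ∀ i, ∀ᵐ x ∂Fi i, x ∈ Set.Icc 0 H := fun i =>
    mem_ae_iff.2 ((prob_compl_eq_zero_iff measurableSet_Icc).2 (hsupp i))
  have hVpi : ∀ᵐ v ∂Measure.pi Fi, ∀ j, v j ∈ Set.Icc 0 H :=
    Filter.eventually_all.2 fun j => Measure.tendsto_eval_ae_ae.eventually (hV j)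
  have hpm : ∀ i, Measurable fun v => ENNReal.ofReal (A.pay v i) := fun i =>
    (A.pay_meas i).ennreal_ofReal
  have ham : ∀ i, Measurable fun v => ENNReal.ofReal (A.alloc v i) * Φ i (v i) := fun i =>
    (A.alloc_meas i).ennreal_ofReal.mul ((hΦm i).comp (measurable_pi_apply i))
  calc ∫⁻ v, ∑ i, ENNReal.ofReal (A.pay v i) ∂Measure.pi Fi
    _ = ∑ i, ∫⁻ v, ENNReal.ofReal (A.pay v i) ∂Measure.pi Fi :=
      lintegral_finsetSum _ fun i _ => hpm i
    _ ≤ ∑ i, ∫⁻ v, ENNReal.ofReal (A.alloc v i) * Φ i (v i) ∂Measure.pi Fi := by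
      refine Finset.sum_le_sum fun i _ => ?_
      rw [lintegral_pi_eq_lintegral_update Fi i (hpm i),
        lintegral_pi_eq_lintegral_update Fi i (ham i)]
      refine lintegral_mono_ae (hVpi.mono fun v hv => ?_)
      have hupd : ∀ x ∈ Set.Icc 0 H, ∀ j, Function.update v i x j ∈ Set.Icc 0 H := by
        intro x hx j
        by_cases hj : j = i
        · subst hj; simpa using hx
        · simpa [hj] using hv j
      have := lintegral_pay_le_lintegral_alloc_mul (hV i) (Φ := Φ i)
        (a := fun x => A.alloc (Function.update v i x) i)
        (q := fun x => A.pay (Function.update v i x) i)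
        (fun p hp ⟨b, hb, hpb⟩ => hΦ i p ⟨hp, hpb.trans hb.2⟩)
        (fun x => A.alloc01 _ i) (fun x => A.pay_nonneg _ i)
        (fun x hx => by simpa using A.pay_le _ (hupd x hx) i)
        (fun x hx b hb => by simpa using A.dsic _ (hupd x hx) i b hb)
      simpa using this
    _ = ∫⁻ v, ∑ i, ENNReal.ofReal (A.alloc v i) * Φ i (v i) ∂Measure.pi Fi :=
      (lintegral_finsetSum _ fun i _ => ham i).symm
    _ ≤ ∫⁻ v, M v ∂Measure.pi Fi := by
      refine lintegral_mono fun v => ?_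
      calc ∑ i, ENNReal.ofReal (A.alloc v i) * Φ i (v i)
        _ ≤ ∑ i, ENNReal.ofReal (A.alloc v i) * M v := by
          gcongr with i
          exact hM v i
        _ = ENNReal.ofReal (∑ i, A.alloc v i) * M v := by
          rw [← Finset.sum_mul, ENNReal.ofReal_sum_of_nonneg fun i _ => by
            rcases A.alloc01 v i with h | h <;> simp [h]]
        _ ≤ 1 * M v := by
          gcongr
          exact ENNReal.ofReal_le_one.2 (A.feas v)
        _ = M v := one_mul _

/-- Bidder `i` is the first bidder whose value exceeds `α`. -/
def IsFirstAbove {n : ℕ} (α : ℝ) (v : Fin n → ℝ) (i : Fin n) : Prop :=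
  α < v i ∧ ∀ j < i, v j ≤ α

theorem IsFirstAbove.eq {n : ℕ} {α : ℝ} {v : Fin n → ℝ} {i j : Fin n}
    (hi : IsFirstAbove α v i) (hj : IsFirstAbove α v j) : i = j := by
  rcases lt_trichotomy i j with h | h | h
  · exact absurd hi.1 (not_lt.2 (hj.2 i h))
  · exact h
  · exact absurd hj.1 (not_lt.2 (hi.2 j h))

theorem measurableSet_isFirstAbove {n : ℕ} (α : ℝ) (i : Fin n) :
    MeasurableSet {v : Fin n → ℝ | IsFirstAbove α v i} := by
  unfold IsFirstAbove
  measurability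

/-- Offer the item at price `α` to the bidders one after the other. -/
noncomputable def sequentialPosting (n : ℕ) (V : Set ℝ) {α : ℝ} (hα : 0 ≤ α) :
    SIAuction n V where
  alloc v i := if IsFirstAbove α v i then 1 else 0
  pay v i := if IsFirstAbove α v i then α else 0
  alloc_meas i := Measurable.ite (measurableSet_isFirstAbove α i) measurable_const measurable_const
  pay_meas i := Measurable.ite (measurableSet_isFirstAbove α i) measurable_const measurable_const
  alloc01 v i := by split_ifs <;> simp
  feas v := by
    by_cases h : ∃ i, IsFirstAbove α v i
    · obtain ⟨i, hi⟩ := h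
      rw [Finset.sum_eq_single i (fun j _ hj => if_neg fun h => hj (h.eq hi)) (by simp),
        if_pos hi]
    · push Not at h
      simp [h]
  pay_nonneg v i := by split_ifs <;> simp [hα]
  pay_le v _ i := by
    split_ifs with h
    · simpa using h.1.le
    · simp
  dsic v _ i b _ := by
    have hrest : IsFirstAbove α (Function.update v i b) i ↔ α < b ∧ ∀ j < i, v j ≤ α := by
      unfold IsFirstAbove
      rw [Function.update_self]
      refine and_congr_right fun _ => forall₂_congr fun j hj => ?_
      rw [Function.update_of_ne hj.ne]
    rw [hrest]
    unfold IsFirstAbove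
    generalize (∀ j < i, v j ≤ α) = P
    by_cases hP : P <;> by_cases h1 : α < v i <;> by_cases h2 : α < b <;>
      simp [hP, h1, h2] <;> linarith

theorem ofReal_mul_le_lintegral_sequentialPosting {n : ℕ} (V : Set ℝ) {α : ℝ} (hα : 0 ≤ α)
    (F : Measure (Fin n → ℝ)) :
    ENNReal.ofReal α * F {v | ∃ i, α < v i} ≤
      ∫⁻ v, ∑ i, ENNReal.ofReal ((sequentialPosting n V hα).pay v i) ∂F := by
  have hm : MeasurableSet {v : Fin n → ℝ | ∃ i, α < v i} := by measurability
  rw [← lintegral_indicator_const hm]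
  refine lintegral_mono fun v => ?_
  rw [Set.indicator_apply]
  split_ifs with hv
  swap
  · exact zero_le
  obtain ⟨i, hi, hmin⟩ := WellFounded.has_min wellFounded_lt {i | α < v i} hv
  refine le_trans ?_ (Finset.single_le_sum (fun _ _ => zero_le) (Finset.mem_univ i))
  have : IsFirstAbove α v i := ⟨hi, fun j hj => not_lt.1 fun h => hmin j h hj⟩
  simp [sequentialPosting, this]

namespace TLevel

/-- The number of thresholds of bidder `i` met by the bid `b`. -/
noncomputable def met {n t : ℕ} (A : TLevel n t) (i : Fin n) (b : ℝ) : ℕ :=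
  (Finset.univ.filter fun τ : Fin t => A.thr i τ ≤ b).card

theorem met_le {n t : ℕ} (A : TLevel n t) (i : Fin n) (b : ℝ) : A.met i b ≤ t :=
  (Finset.card_le_univ _).trans_eq (Fintype.card_fin t)

theorem lt_met_iff {n t : ℕ} (A : TLevel n t) (i : Fin n) (b : ℝ) (k : Fin t) :
    (k : ℕ) < A.met i b ↔ A.thr i k ≤ b := by
  refine ⟨fun h => ?_, fun h => ?_⟩
  · by_contra hk
    have hsub : (Finset.univ.filter fun τ : Fin t => A.thr i τ ≤ b) ⊆ Finset.Iio k := by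
      intro τ hτ
      rw [Finset.mem_filter] at hτ
      rw [Finset.mem_Iio]
      by_contra hkτ
      exact hk ((A.mono i (not_lt.1 hkτ)).trans hτ.2)
    have := Finset.card_le_card hsub
    rw [Fin.card_Iio] at this
    exact absurd h (not_lt.2 this)
  · have hsub : Finset.Iic k ⊆ (Finset.univ.filter fun τ : Fin t => A.thr i τ ≤ b) := by
      intro τ hτ
      rw [Finset.mem_Iic] at hτ
      exact Finset.mem_filter.2 ⟨Finset.mem_univ _, (A.mono i hτ).trans h⟩
    have := Finset.card_le_card hsub
    rw [Fin.card_Iic] at this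
    exact this

theorem measurable_met {n t : ℕ} (A : TLevel n t) (i : Fin n) : Measurable (A.met i) := by
  refine Monotone.measurable fun b b' hb => Finset.card_le_card fun τ hτ => ?_
  rw [Finset.mem_filter] at hτ ⊢
  exact ⟨hτ.1, hτ.2.trans hb⟩

/-- Given the numbers `m` of thresholds met by the bidders, bidder `i` wins exactly when she meets
more than this number of thresholds. It does not depend on `m i`. -/
noncomputable def rivalRank {n : ℕ} (succ : Fin n → Fin n → Prop) (i : Fin n) (m : Fin n → ℕ) : ℕ :=
  Finset.univ.sup fun j => if j = i then 0 else if succ i j then m j - 1 else m j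

theorem rivalRank_lt_iff {n : ℕ} (succ : Fin n → Fin n → Prop) (i : Fin n) (m : Fin n → ℕ) :
    rivalRank succ i m < m i ↔
      0 < m i ∧ ∀ j, j ≠ i → m j < m i ∨ (m j = m i ∧ succ i j) := by
  have hpos : rivalRank succ i m < m i → 0 < m i := fun h => (Nat.zero_le _).trans_lt h
  by_cases h0 : 0 < m i
  · rw [rivalRank, Finset.sup_lt_iff (by simpa using h0)]
    simp only [Finset.mem_univ, true_implies, h0, true_and]
    refine forall_congr' fun j => ?_
    by_cases hj : j = i
    · simp [hj, h0]
    · by_cases hs : succ i j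
      · simp only [hj, hs, if_true, if_false, ne_eq, not_false_eq_true, true_implies, and_true]
        omega
      · simp [hj, hs]
  · exact iff_of_false (fun h => h0 (hpos h)) fun h => h0 h.1

theorem rivalRank_met_update {n t : ℕ} (A : TLevel n t) (succ : Fin n → Fin n → Prop) (i : Fin n)
    (v : Fin n → ℝ) (x : ℝ) :
    rivalRank succ i (fun j => A.met j (Function.update v i x j)) =
      rivalRank succ i fun j => A.met j (v j) := by
  refine Finset.sup_congr rfl fun j _ => ?_
  by_cases hj : j = i <;> simp [hj]

theorem wins_iff {n t : ℕ} (A : TLevel n t) (succ : Fin n → Fin n → Prop) (v : Fin n → ℝ)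
    (i : Fin n) :
    A.wins succ v i ↔ rivalRank succ i (fun j => A.met j (v j)) < A.met i (v i) := by
  rw [rivalRank_lt_iff succ i fun j => A.met j (v j)]
  have hl : ∀ j b, A.level j b = (A.met j b : ℤ) - 1 := fun _ _ => rfl
  simp only [wins, hl, sub_nonneg, sub_lt_sub_iff_right, sub_left_inj, Nat.cast_lt, Nat.cast_inj]
  exact and_congr_left fun _ => by omega

theorem wins_update_iff_s5 {n t : ℕ} (A : TLevel n t) (succ : Fin n → Fin n → Prop) (v : Fin n → ℝ)
    (i : Fin n) (x : ℝ) :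
    A.wins succ (Function.update v i x) i ↔
      ∃ h : rivalRank succ i (fun j => A.met j (v j)) < t, A.thr i ⟨_, h⟩ ≤ x := by
  rw [wins_iff, rivalRank_met_update, Function.update_self]
  refine ⟨fun h => ?_, fun ⟨h, hx⟩ => (A.lt_met_iff i x ⟨_, h⟩).2 hx⟩
  have ht := h.trans_le (A.met_le i x)
  exact ⟨ht, (A.lt_met_iff i x ⟨_, ht⟩).1 h⟩

theorem payment_eq {n t : ℕ} (A : TLevel n t) (succ : Fin n → Fin n → Prop) (v : Fin n → ℝ)
    (i : Fin n) (h : rivalRank succ i (fun j => A.met j (v j)) < t) :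
    A.payment succ v i = A.thr i ⟨_, h⟩ := by
  have : {b : ℝ | A.wins succ (Function.update v i b) i} = Set.Ici (A.thr i ⟨_, h⟩) := by
    ext b
    simp [wins_update_iff_s5, h]
  rw [payment, this, csInf_Ici]

theorem exists_rivalRank_lt {n : ℕ} {succ : Fin n → Fin n → Prop}
    (hs : IsStrictTotalOrder (Fin n) succ) {m : Fin n → ℕ} (hm : 0 < Finset.univ.sup m) :
    ∃ i, rivalRank succ i m < m i ∧ m i = Finset.univ.sup m := by
  have hne : (Finset.univ : Finset (Fin n)).Nonempty := by
    by_contra h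
    rw [Finset.not_nonempty_iff_eq_empty] at h
    simp [h] at hm
  obtain ⟨i₀, -, hi₀⟩ := Finset.exists_mem_eq_sup _ hne m
  obtain ⟨i, hi, hmin⟩ := WellFounded.has_min
    (Finite.wellFounded_of_trans_of_irrefl succ) {i | m i = Finset.univ.sup m} ⟨i₀, hi₀.symm⟩
  rw [Set.mem_ofPred_eq] at hi
  refine ⟨i, (rivalRank_lt_iff succ i m).2 ⟨hi ▸ hm, fun j hj => ?_⟩, hi⟩
  have hle : m j ≤ m i := hi ▸ Finset.le_sup (Finset.mem_univ j)
  rcases hle.lt_or_eq with h | h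
  · exact Or.inl h
  · refine Or.inr ⟨h, ?_⟩
    by_contra hij
    exact hj (Std.Trichotomous.trichotomous (r := succ) j i (hmin j (h.trans hi)) hij)

theorem ofReal_Rev {n t : ℕ} (A : TLevel n t) (succ : Fin n → Fin n → Prop)
    (hthr : ∀ i τ, 0 ≤ A.thr i τ) (v : Fin n → ℝ) :
    ENNReal.ofReal (A.Rev succ v) =
      ∑ i, ENNReal.ofReal (if A.wins succ v i then A.payment succ v i else 0) := by
  refine ENNReal.ofReal_sum_of_nonneg fun i _ => ?_
  split_ifs with h
  · have hlt := ((A.wins_iff succ v i).1 h).trans_le (A.met_le i (v i))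
    rw [payment_eq A succ v i hlt]
    exact hthr _ _
  · exact le_rfl

theorem measurable_ofReal_payment {n t : ℕ} (A : TLevel n t) (succ : Fin n → Fin n → Prop)
    (i : Fin n) :
    Measurable fun v =>
      ENNReal.ofReal (if A.wins succ v i then A.payment succ v i else 0) := by
  have hm : Measurable fun v : Fin n → ℝ => fun j => A.met j (v j) :=
    measurable_pi_lambda _ fun j => (A.measurable_met j).comp (measurable_pi_apply j)
  let g : (Fin n → ℕ) → ℝ≥0∞ := fun m =>
    if rivalRank succ i m < m i then
      if h : rivalRank succ i m < t then ENNReal.ofReal (A.thr i ⟨_, h⟩) else 0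
    else 0
  have hg : Measurable g := Measurable.of_discrete
  convert hg.comp hm using 1
  funext v
  simp only [g, Function.comp, wins_iff]
  split_ifs with h h'
  · rw [payment_eq A succ v i h']
  · exact absurd (h.trans_le (A.met_le i (v i))) h'
  · simp

/-- The expected revenue of a level auction is at least the expected lower surplus bound at the
highest level, if every threshold price earns its lower surplus bound. -/
theorem lintegral_le_lintegral_Rev {n t : ℕ} (A : TLevel n t) {succ : Fin n → Fin n → Prop}
    (hs : IsStrictTotalOrder (Fin n) succ) (hthr : ∀ i τ, 0 ≤ A.thr i τ)
    {Fi : Fin n → Measure ℝ} [∀ i, IsProbabilityMeasure (Fi i)] {φ : ℕ → ℝ≥0∞}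
    (hφ0 : φ 0 = 0)
    (hφ : ∀ i k, ∫⁻ x in Set.Ici (A.thr i k), φ (A.met i x) ∂Fi i ≤
      ENNReal.ofReal (A.thr i k) * Fi i (Set.Ici (A.thr i k))) :
    ∫⁻ v, φ (Finset.univ.sup fun i => A.met i (v i)) ∂Measure.pi Fi ≤
      ∫⁻ v, ENNReal.ofReal (A.Rev succ v) ∂Measure.pi Fi := by
  have hm : Measurable fun v : Fin n → ℝ => fun j => A.met j (v j) :=
    measurable_pi_lambda _ fun j => (A.measurable_met j).comp (measurable_pi_apply j)
  let g : Fin n → (Fin n → ℕ) → ℝ≥0∞ := fun i m => if rivalRank succ i m < m i then φ (m i) else 0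
  have hg : ∀ i, Measurable fun v : Fin n → ℝ => g i fun j => A.met j (v j) := fun i =>
    (Measurable.of_discrete (f := g i)).comp hm
  calc ∫⁻ v, φ (Finset.univ.sup fun i => A.met i (v i)) ∂Measure.pi Fi
    _ ≤ ∫⁻ v, ∑ i, g i (fun j => A.met j (v j)) ∂Measure.pi Fi := by
      refine lintegral_mono fun v => ?_
      rcases Nat.eq_zero_or_pos (Finset.univ.sup fun i => A.met i (v i)) with h | h
      · rw [h, hφ0]
        exact zero_le
      · obtain ⟨i, hi, hmi⟩ := exists_rivalRank_lt hs h
        refine le_trans ?_ (Finset.single_le_sum (fun _ _ => zero_le) (Finset.mem_univ i))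
        simp only [g, if_pos hi]
        rw [hmi]
    _ = ∑ i, ∫⁻ v, g i (fun j => A.met j (v j)) ∂Measure.pi Fi :=
      lintegral_finsetSum _ fun i _ => hg i
    _ ≤ ∑ i, ∫⁻ v, ENNReal.ofReal (if A.wins succ v i then A.payment succ v i else 0)
        ∂Measure.pi Fi := by
      refine Finset.sum_le_sum fun i _ => ?_
      rw [lintegral_pi_eq_lintegral_update Fi i (hg i),
        lintegral_pi_eq_lintegral_update Fi i (A.measurable_ofReal_payment succ i)]
      refine lintegral_mono fun v => ?_
      by_cases h : rivalRank succ i (fun j => A.met j (v j)) < t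
      · calc ∫⁻ x, g i (fun j => A.met j (Function.update v i x j)) ∂Fi i
          _ = ∫⁻ x in Set.Ici (A.thr i ⟨_, h⟩), φ (A.met i x) ∂Fi i := by
            rw [← lintegral_indicator measurableSet_Ici]
            refine lintegral_congr fun x => ?_
            simp only [g, rivalRank_met_update, Function.update_self, Set.indicator_apply,
              Set.mem_Ici]
            exact if_congr (A.lt_met_iff i x ⟨_, h⟩) rfl rfl
          _ ≤ ENNReal.ofReal (A.thr i ⟨_, h⟩) * Fi i (Set.Ici (A.thr i ⟨_, h⟩)) := hφ i ⟨_, h⟩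
          _ = _ := by
            rw [← lintegral_indicator_const measurableSet_Ici]
            refine lintegral_congr fun x => ?_
            have h' := h
            rw [← A.rivalRank_met_update succ i v x] at h'
            rw [payment_eq A succ _ i h', Set.indicator_apply]
            simp [wins_update_iff_s5, h, rivalRank_met_update, apply_ite ENNReal.ofReal]
      · have : ∀ x, g i (fun j => A.met j (Function.update v i x j)) = 0 := fun x => by
          simp only [g, rivalRank_met_update, Function.update_self]
          exact if_neg fun hx => h (hx.trans_le (A.met_le i x))
        simp [this]
    _ = ∫⁻ v, ENNReal.ofReal (A.Rev succ v) ∂Measure.pi Fi := by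
      simp only [A.ofReal_Rev succ hthr]
      exact (lintegral_finsetSum _ fun i _ => A.measurable_ofReal_payment succ i).symm

end TLevel

/-- With `t` of the stated order, the geometric grid of surplus values reaches `H`. -/
theorem le_grid_of_le {H α γ ε : ℝ} (hα : α ∈ Set.Ioc 0 H) (hγ : γ ∈ Set.Ioo (0 : ℝ) 1)
    (hε : ε ∈ Set.Ioo (0 : ℝ) 1) {t : ℕ}
    (ht : 6 * (1 / (γ * ε) + Real.log (H / α) / Real.log (1 + ε)) ≤ t) :
    H ≤ γ * α * ((1 + ε / 2) ^ t - 1) := by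
  obtain ⟨hα0, hαH⟩ := hα
  obtain ⟨hγ0, hγ1⟩ := hγ
  obtain ⟨hε0, hε1⟩ := hε
  have hH : 0 < H := hα0.trans_le hαH
  have hB : 0 < γ * α := mul_pos hγ0 hα0
  have hL : 0 ≤ Real.log (H / α) := Real.log_nonneg ((one_le_div hα0).2 hαH)
  have hl : 0 < Real.log (1 + ε) := Real.log_pos (by linarith)
  have h1 : ε / 3 ≤ Real.log (1 + ε / 2) := by
    refine le_trans ?_ (Real.one_sub_inv_le_log_of_pos (by positivity))
    rw [le_sub_iff_add_le, ← le_sub_iff_add_le', inv_le_iff_one_le_mul₀ (by positivity)]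
    nlinarith
  have h2 : Real.log (1 + ε) ≤ 2 * Real.log (1 + ε / 2) := by
    rw [← Real.log_rpow (by positivity)]
    refine Real.log_le_log (by positivity) ?_
    rw [Real.rpow_two]
    nlinarith
  have h3 : Real.log (1 + H / (γ * α)) ≤ Real.log (H / α) + 2 / γ := by
    have hle : 1 + H / (γ * α) ≤ (H / α) * (2 / γ) := by
      have : 1 ≤ H / (γ * α) := (one_le_div hB).2 (by nlinarith)
      have h' : (H / α) * (2 / γ) = 2 * (H / (γ * α)) := by field_simp
      linarith
    calc Real.log (1 + H / (γ * α)) ≤ Real.log ((H / α) * (2 / γ)) :=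
          Real.log_le_log (by positivity) hle
      _ = Real.log (H / α) + Real.log (2 / γ) :=
          Real.log_mul (by positivity) (by positivity)
      _ ≤ Real.log (H / α) + 2 / γ := by
          have := Real.log_le_sub_one_of_pos (show 0 < 2 / γ by positivity)
          linarith
  have h4 : Real.log (H / α) + 2 / γ ≤ t * Real.log (1 + ε / 2) := by
    have ha : 2 / γ ≤ 6 * (1 / (γ * ε)) * Real.log (1 + ε / 2) :=
      calc 2 / γ = 6 * (1 / (γ * ε)) * (ε / 3) := by field_simp; norm_num
        _ ≤ _ := by gcongr
    have hb : Real.log (H / α) ≤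
        6 * (Real.log (H / α) / Real.log (1 + ε)) * Real.log (1 + ε / 2) :=
      calc Real.log (H / α) = (Real.log (H / α) / Real.log (1 + ε)) * Real.log (1 + ε) := by
            field_simp
        _ ≤ (Real.log (H / α) / Real.log (1 + ε)) * (6 * Real.log (1 + ε / 2)) := by
            gcongr
            linarith
        _ = _ := by ring
    have hc := mul_le_mul_of_nonneg_right ht (show 0 ≤ Real.log (1 + ε / 2) by linarith)
    linarith
  have h5 : 1 + H / (γ * α) ≤ (1 + ε / 2) ^ t := by
    rw [← Real.log_le_log_iff (by positivity) (by positivity), Real.log_pow]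
    exact h3.trans h4
  calc H = γ * α * (H / (γ * α)) := by field_simp
    _ ≤ _ := by gcongr; linarith

/-- If `U ≤ (1 + ε / 2) L + (ε / 2) B` and `B ≤ U`, then `L` is a `(1 - ε)`-approximation of `U`. -/
theorem ofReal_one_sub_mul_le {ε B : ℝ} (hε : ε ∈ Set.Ioo (0 : ℝ) 1) (hB : 0 ≤ B) {U L : ℝ≥0∞}
    (hU : U ≠ ⊤) (hL : L ≠ ⊤) (hBU : ENNReal.ofReal B ≤ U)
    (hUL : U ≤ ENNReal.ofReal (1 + ε / 2) * L + ENNReal.ofReal (ε / 2 * B)) :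
    ENNReal.ofReal (1 - ε) * U ≤ L := by
  obtain ⟨hε0, hε1⟩ := hε
  rw [← ENNReal.ofReal_toReal hU, ← ENNReal.ofReal_toReal hL] at *
  have hU0 : 0 ≤ U.toReal := ENNReal.toReal_nonneg
  have hL0 : 0 ≤ L.toReal := ENNReal.toReal_nonneg
  generalize U.toReal = u at *
  generalize L.toReal = l at *
  rw [ENNReal.ofReal_le_ofReal_iff hU0] at hBU
  rw [← ENNReal.ofReal_mul (by positivity), ← ENNReal.ofReal_add (by positivity) (by positivity),
    ENNReal.ofReal_le_ofReal_iff (by positivity)] at hUL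
  rw [← ENNReal.ofReal_mul (by linarith)]
  refine ENNReal.ofReal_le_ofReal ?_
  have h : (1 + ε / 2) * ((1 - ε) * u) ≤ (1 + ε / 2) * l := by
    nlinarith [mul_le_mul_of_nonneg_left hBU hε0.le, mul_nonneg (mul_nonneg hε0.le hε0.le) hU0]
  exact le_of_mul_le_mul_left h (by positivity)

/-- Representation error of `t`-level single-item auctions (general bounded form,
Lemma "levels"): there is a universal constant `c > 0` such that for bidders with
atomless valuations supported in `[0,H]` satisfying `P[max_i v_i > α] ≥ γ`, and every
`t ≥ c (1/(γε) + ln(H/α)/ln(1+ε))`, some `t`-level auction earns expected revenue at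
least `(1-ε)` times the optimal revenue. -/
theorem representation_error_tlevel_general_bounded :
    ∃ c : ℝ, 0 < c ∧
      ∀ n : ℕ, 1 ≤ n →
      ∀ H α : ℝ, 0 < H → α ∈ Set.Ioc (0 : ℝ) H →
      ∀ γ ε : ℝ, γ ∈ Set.Ioo (0 : ℝ) 1 → ε ∈ Set.Ioo (0 : ℝ) 1 →
      ∀ Fi : Fin n → Measure ℝ,
        (∀ i, IsProbabilityMeasure (Fi i)) →
        (∀ i, ∀ x : ℝ, Fi i {x} = 0) →
        (∀ i, Fi i (Set.Icc 0 H) = 1) →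
        ENNReal.ofReal γ ≤ Measure.pi Fi {v | ∃ i, α < v i} →
      ∀ t : ℕ, c * (1 / (γ * ε) + Real.log (H / α) / Real.log (1 + ε)) ≤ t →
      ∀ succ : Fin n → Fin n → Prop, IsStrictTotalOrder (Fin n) succ →
      ∃ A : TLevel n t,
        ENNReal.ofReal (1 - ε) * OPT n (Set.Icc 0 H) (Measure.pi Fi) ≤
          ∫⁻ v, ENNReal.ofReal (A.Rev succ v) ∂(Measure.pi Fi) := by
  refine ⟨6, by norm_num, ?_⟩
  intro n _ H α hH hα γ ε hγ hε Fi hprob hatom hsupp hmass t ht succ hsucc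
  have hna : ∀ i, NullSingletonClass (Fi i) := fun i => ⟨hatom i⟩
  have hα0 : 0 < α := hα.1
  have hγ0 : 0 < γ := hγ.1
  have hε0 : 0 < ε := hε.1
  have hB : 0 < γ * α := mul_pos hγ0 hα0
  let r : ℕ → ℝ := fun j => γ * α * ((1 + ε / 2) ^ j - 1)
  have hr : Monotone r := fun j k hjk =>
    mul_le_mul_of_nonneg_left
      (sub_le_sub_right (pow_le_pow_right₀ (by linarith) hjk) 1) hB.le
  have hr0 : r 0 = 0 := by simp [r]
  have hrn : ∀ j, 0 ≤ r j := fun j => hr0 ▸ hr (Nat.zero_le j)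
  have hrt : H ≤ r t := le_grid_of_le hα hγ hε ht
  have hstep : ∀ N, r N ≤ (1 + ε / 2) * r (N - 1) + ε / 2 * (γ * α) := by
    rintro (_ | N)
    · simp only [Nat.zero_sub, hr0]
      positivity
    · refine le_of_eq ?_
      simp only [r, Nat.add_sub_cancel]
      ring
  choose price hmono hmem hopt using fun i => exists_monotone_optimal_price (Fi i) hH
  let A : TLevel n t := ⟨fun i τ => price i (r τ), fun i τ τ' h => hmono i (hr h)⟩
  have hthr : ∀ i τ, 0 ≤ A.thr i τ := fun i τ => (hmem i _).1
  have hN : ∀ i x, ∀ j < t, j < A.met i x ↔ price i (r j) ≤ x := fun i x j hj =>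
    A.lt_met_iff i x ⟨j, hj⟩
  set F := Measure.pi Fi
  set U := ∫⁻ v, ENNReal.ofReal (r (Finset.univ.sup fun i => A.met i (v i))) ∂F
  set L := ∫⁻ v, ENNReal.ofReal (r ((Finset.univ.sup fun i => A.met i (v i)) - 1)) ∂F with hL
  have hupper : ∀ M : SIAuction n (Set.Icc 0 H),
      ∫⁻ v, ∑ i, ENNReal.ofReal (M.pay v i) ∂F ≤ U := fun M =>
    M.lintegral_pay_le hsupp (Φ := fun i x => ENNReal.ofReal (r (A.met i x)))
      (fun i => (Measurable.of_discrete (f := fun k => ENNReal.ofReal (r k))).comp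
        (A.measurable_met i))
      (fun i p hp => price_mul_le_setLIntegral hr hr0 hrt (fun j => hmem i (r j))
        (fun j => hopt i (r j)) (A.met_le i) (hN i) hp)
      (fun v i => ENNReal.ofReal_le_ofReal
        (hr (Finset.le_sup (f := fun i => A.met i (v i)) (Finset.mem_univ i))))
  have hOPT : OPT n (Set.Icc 0 H) F ≤ U := iSup_le hupper
  have hlower : L ≤ ∫⁻ v, ENNReal.ofReal (A.Rev succ v) ∂F :=
    A.lintegral_le_lintegral_Rev hsucc hthr (φ := fun k => ENNReal.ofReal (r (k - 1)))
      (by simp [hr0]) fun i k => setLIntegral_le_threshold_mul hH.le (hsupp i) hr hr0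
        (ℓ := fun j => price i (r j)) (fun j => hmem i (r j)) (fun j => hopt i (r j))
        (A.met_le i) (hN i) k.2
  have hBU : ENNReal.ofReal (γ * α) ≤ U :=
    calc ENNReal.ofReal (γ * α) = ENNReal.ofReal α * ENNReal.ofReal γ := by
          rw [mul_comm, ENNReal.ofReal_mul hα0.le]
      _ ≤ ENNReal.ofReal α * F {v | ∃ i, α < v i} := by gcongr
      _ ≤ U := (ofReal_mul_le_lintegral_sequentialPosting _ hα0.le F).trans (hupper _)
  have hUL : U ≤ ENNReal.ofReal (1 + ε / 2) * L + ENNReal.ofReal (ε / 2 * (γ * α)) := by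
    calc U ≤ ∫⁻ v, (ENNReal.ofReal (1 + ε / 2) *
          ENNReal.ofReal (r ((Finset.univ.sup fun i => A.met i (v i)) - 1)) +
          ENNReal.ofReal (ε / 2 * (γ * α))) ∂F := by
          refine lintegral_mono fun v => ?_
          rw [← ENNReal.ofReal_mul (by positivity),
            ← ENNReal.ofReal_add (mul_nonneg (by positivity) (hrn _)) (by positivity)]
          exact ENNReal.ofReal_le_ofReal (hstep _)
      _ = _ := by
          rw [lintegral_add_right _ measurable_const, lintegral_const,
            lintegral_const_mul' _ _ ENNReal.ofReal_ne_top]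
          simp [F, hL]
  have hsup : ∀ v : Fin n → ℝ, (Finset.univ.sup fun i => A.met i (v i)) ≤ t := fun v =>
    Finset.sup_le fun i _ => A.met_le i (v i)
  have hUtop : U ≠ ⊤ := by
    refine ne_top_of_le_ne_top (b := ENNReal.ofReal (r t)) ENNReal.ofReal_ne_top ?_
    calc U ≤ ∫⁻ _, ENNReal.ofReal (r t) ∂F := lintegral_mono fun v =>
          ENNReal.ofReal_le_ofReal (hr (hsup v))
      _ = ENNReal.ofReal (r t) := by simp [F]
  have hLtop : L ≠ ⊤ := ne_top_of_le_ne_top hUtop <| lintegral_mono fun v =>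
    ENNReal.ofReal_le_ofReal (hr (Nat.sub_le _ 1))
  have hfinal := ofReal_one_sub_mul_le hε hB.le hUtop hLtop hBU hUL
  exact ⟨A, (mul_le_mul_right hOPT _).trans (hfinal.trans hlower)⟩
end
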